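/- arXiv:0911.3570 — 2 statements merged into one kernel-verified Lean document; each statement's English description precedes it below -/
import Mathlib

section
/- Let B be a quadratic real division algebra of dimension at least four and T : B → B an invertible linear map. The isotope B_T (with multiplication x ∘ y = (Tx)·(Ty)) is power-commutative if and only if T = λS for some planar map S : B → B and some nonzero scalar λ ∈ ℝ. Moreover, if T itself is planar, then the identity element 1 of B is an omnipresent idempotent of B_T. -/
open Module

section Defs

variable {A : Type*} [AddCommGroup A] [Module ℝ A]

/-- A linear subspace closed under the multiplication `m`. -/
def IsSubalg (m : A →ₗ[ℝ] A →ₗ[ℝ] A) (U : Submodule ℝ A) : Prop :=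
  ∀ x ∈ U, ∀ y ∈ U, m x y ∈ U

/-- The subalgebra generated by a set `s`: the smallest subspace containing `s`
and closed under multiplication. -/
def genSubalg (m : A →ₗ[ℝ] A →ₗ[ℝ] A) (s : Set A) : Submodule ℝ A :=
  sInf {U : Submodule ℝ A | IsSubalg m U ∧ s ⊆ (U : Set A)}

/-- `m` is a division-algebra multiplication: for nonzero `a`, both left and
right multiplication by `a` are bijective. -/
def IsDivision (m : A →ₗ[ℝ] A →ₗ[ℝ] A) : Prop :=
  ∀ a : A, a ≠ 0 →
    Function.Bijective (fun x : A => m a x) ∧ Function.Bijective (fun x : A => m x a)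

/-- Power-commutativity: every subalgebra generated by a single element is commutative. -/
def PowerComm (m : A →ₗ[ℝ] A →ₗ[ℝ] A) : Prop :=
  ∀ x : A, ∀ a ∈ genSubalg m {x}, ∀ b ∈ genSubalg m {x}, m a b = m b a

/-- An omnipresent idempotent: a nonzero idempotent contained in every
two-dimensional subalgebra. -/
def Omnipresent (m : A →ₗ[ℝ] A →ₗ[ℝ] A) (e : A) : Prop :=
  e ≠ 0 ∧ m e e = e ∧
    ∀ U : Submodule ℝ A, IsSubalg m U → Module.finrank ℝ U = 2 → e ∈ U

/-- `one` is an identity element for `m` and for every `x` the elements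
`one, x, x²` are linearly dependent. -/
def IsQuadraticWith (m : A →ₗ[ℝ] A →ₗ[ℝ] A) (one : A) : Prop :=
  (∀ x : A, m one x = x ∧ m x one = x) ∧
    ∀ x : A, ¬ LinearIndependent ℝ ![one, x, m x x]

/-- A quadratic algebra: unital, and `1, x, x²` linearly dependent for all `x`. -/
def IsQuadratic (m : A →ₗ[ℝ] A →ₗ[ℝ] A) : Prop :=
  ∃ one : A, IsQuadraticWith m one

/-- The isotope multiplication `x ∘ y = (T x)·(T y)`. -/
def isotope (m : A →ₗ[ℝ] A →ₗ[ℝ] A) (T : A →ₗ[ℝ] A) : A →ₗ[ℝ] A →ₗ[ℝ] A :=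
  (m.compl₂ T).comp T

/-- A planar map on a quadratic division algebra with identity `one`:
invertible, fixes `one`, and leaves every subalgebra invariant. -/
def Planar (m : A →ₗ[ℝ] A →ₗ[ℝ] A) (one : A) (T : A →ₗ[ℝ] A) : Prop :=
  Function.Bijective T ∧ T one = one ∧
    ∀ U : Submodule ℝ A, IsSubalg m U → ∀ x ∈ U, T x ∈ U

/-- The imaginary space `Im B = {x ∉ ℝ·1 : x² ∈ ℝ·1} ∪ {0}` of a quadratic algebra. -/
def ImSet (m : A →ₗ[ℝ] A →ₗ[ℝ] A) (one : A) : Set A :=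
  {x : A | x ∉ Submodule.span ℝ {one} ∧ m x x ∈ Submodule.span ℝ {one}} ∪ {0}

/-- The centraliser `C(e) = {y : e·y = y·e}`, a linear subspace. -/
def centraliser (m : A →ₗ[ℝ] A →ₗ[ℝ] A) (e : A) : Submodule ℝ A :=
  LinearMap.ker (m e - m.flip e)

/-- An exceptional idempotent of a four-dimensional algebra: its centraliser is
three-dimensional and closed under squaring. -/
def Exceptional (m : A →ₗ[ℝ] A →ₗ[ℝ] A) (e : A) : Prop :=
  Module.finrank ℝ (centraliser m e) = 3 ∧
    ∀ x ∈ centraliser m e, m x x ∈ centraliser m e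

end Defs

section QuadraticAlgebra

variable {A : Type*} [AddCommGroup A] [Module ℝ A]

lemma coeff_eq_zero_of_smul_mem {U : Submodule ℝ A} {c : ℝ} {v : A} (h : c • v ∈ U)
    (hv : v ∉ U) : c = 0 := by
  by_contra hc
  exact hv ((U.smul_mem_iff hc).1 h)

lemma isSubalg_genSubalg (m : A →ₗ[ℝ] A →ₗ[ℝ] A) (s : Set A) : IsSubalg m (genSubalg m s) := by
  intro x hx y hy
  simp only [genSubalg, Submodule.mem_sInf, Set.mem_ofPred_eq] at hx hy ⊢
  exact fun U hU => hU.1 x (hx U hU) y (hy U hU)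

lemma subset_genSubalg (m : A →ₗ[ℝ] A →ₗ[ℝ] A) (s : Set A) : s ⊆ genSubalg m s := by
  intro x hx
  simp only [genSubalg, SetLike.mem_coe, Submodule.mem_sInf, Set.mem_ofPred_eq]
  exact fun U hU => hU.2 hx

lemma genSubalg_le {m : A →ₗ[ℝ] A →ₗ[ℝ] A} {s : Set A} {U : Submodule ℝ A}
    (hU : IsSubalg m U) (hs : s ⊆ U) : genSubalg m s ≤ U :=
  sInf_le ⟨hU, hs⟩

@[simp]
lemma isotope_apply (m : A →ₗ[ℝ] A →ₗ[ℝ] A) (T : A →ₗ[ℝ] A) (x y : A) :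
    isotope m T x y = m (T x) (T y) := rfl

lemma IsDivision.eq_zero_of_mul_eq_zero {m : A →ₗ[ℝ] A →ₗ[ℝ] A} (hdiv : IsDivision m) {x y : A}
    (hx : x ≠ 0) (h : m x y = 0) : y = 0 :=
  (hdiv x hx).1.1 (by simpa using h)

lemma IsQuadraticWith.exists_sq_eq {m : A →ₗ[ℝ] A →ₗ[ℝ] A} {one : A}
    (hq : IsQuadraticWith m one) (x : A) : ∃ a b : ℝ, m x x = a • x + b • one := by
  obtain ⟨g, hg, i, hi⟩ := Fintype.not_linearIndependent_iff.1 (hq.2 x)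
  simp only [Fin.sum_univ_three, Matrix.cons_val_zero, Matrix.cons_val_one,
    Matrix.cons_val] at hg
  by_cases h2 : g 2 = 0
  · by_cases h1 : g 1 = 0
    · have h0 : g 0 ≠ 0 := by fin_cases i <;> simp_all
      have hone : one = 0 := by simpa [h1, h2, h0] using hg
      have hx : x = 0 := by rw [← (hq.1 x).1, hone]; simp
      exact ⟨0, 0, by simp [hx]⟩
    · have hx : x = (-(g 0 / g 1)) • one := by
        rw [h2] at hg
        have : x = (g 1)⁻¹ • (g 1 • x) := by rw [smul_smul, inv_mul_cancel₀ h1, one_smul]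
        rw [this]
        have h : g 1 • x = -(g 0 • one) := by linear_combination (norm := module) hg
        rw [h]
        module
      refine ⟨-(g 0 / g 1), 0, ?_⟩
      nth_rewrite 1 [hx]
      simp [(hq.1 x).1]
  · refine ⟨-(g 1 / g 2), -(g 0 / g 2), ?_⟩
    have : m x x = (g 2)⁻¹ • (g 2 • m x x) := by rw [smul_smul, inv_mul_cancel₀ h2, one_smul]
    rw [this]
    have h : g 2 • m x x = -(g 0 • one + g 1 • x) := by linear_combination (norm := module) hg
    rw [h]
    module

lemma IsQuadraticWith.isSubalg_span_pair {m : A →ₗ[ℝ] A →ₗ[ℝ] A} {one : A}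
    (hq : IsQuadraticWith m one) (x : A) : IsSubalg m (Submodule.span ℝ {one, x}) := by
  intro y hy z hz
  obtain ⟨a, b, rfl⟩ := Submodule.mem_span_pair.1 hy
  obtain ⟨c, d, rfl⟩ := Submodule.mem_span_pair.1 hz
  obtain ⟨p, q, hpq⟩ := hq.exists_sq_eq x
  refine Submodule.mem_span_pair.2 ⟨a * c + b * d * q, a * d + b * c + b * d * p, ?_⟩
  simp only [map_add, map_smul, LinearMap.add_apply, LinearMap.smul_apply, (hq.1 _).1,
    (hq.1 _).2, hpq]
  module

lemma IsQuadraticWith.mul_comm_of_mem_span_pair {m : A →ₗ[ℝ] A →ₗ[ℝ] A} {one : A}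
    (hq : IsQuadraticWith m one) {x y z : A} (hy : y ∈ Submodule.span ℝ {one, x})
    (hz : z ∈ Submodule.span ℝ {one, x}) : m y z = m z y := by
  obtain ⟨a, b, rfl⟩ := Submodule.mem_span_pair.1 hy
  obtain ⟨c, d, rfl⟩ := Submodule.mem_span_pair.1 hz
  simp only [map_add, map_smul, LinearMap.add_apply, LinearMap.smul_apply, (hq.1 _).1, (hq.1 _).2]
  module

/-- Completing the square: every element is a scalar shift of one whose square is a scalar. -/
lemma IsQuadraticWith.exists_sub_sq_eq {m : A →ₗ[ℝ] A →ₗ[ℝ] A} {one : A}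
    (hq : IsQuadraticWith m one) (x : A) :
    ∃ a b : ℝ, m (x - a • one) (x - a • one) = b • one := by
  obtain ⟨p, q, hpq⟩ := hq.exists_sq_eq x
  refine ⟨p / 2, q + p ^ 2 / 4, ?_⟩
  simp only [map_sub, map_smul, LinearMap.sub_apply, LinearMap.smul_apply, (hq.1 _).1,
    (hq.1 _).2, hpq]
  module

lemma IsQuadraticWith.one_mem_of_isSubalg {m : A →ₗ[ℝ] A →ₗ[ℝ] A} {one : A}
    (hq : IsQuadraticWith m one) (hdiv : IsDivision m) {U : Submodule ℝ A} (hU : IsSubalg m U)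
    {x : A} (hx : x ∈ U) (hx0 : x ≠ 0) : one ∈ U := by
  obtain ⟨a, b, hab⟩ := hq.exists_sq_eq x
  have hb : b • one ∈ U := by
    have h := U.sub_mem (hU x hx x hx) (U.smul_mem a hx)
    rwa [hab, add_sub_cancel_left] at h
  by_contra hone
  have hb0 := coeff_eq_zero_of_smul_mem hb hone
  have hxa : x - a • one = 0 := by
    apply hdiv.eq_zero_of_mul_eq_zero hx0
    simp [hab, hb0, (hq.1 x).2]
  have hxa' : x = a • one := sub_eq_zero.1 hxa
  have ha := coeff_eq_zero_of_smul_mem (hxa' ▸ hx) hone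
  exact hx0 (by simp [hxa', ha])

/-- Commuting elements with scalar squares, the first nonzero, are dependent modulo scalars. -/
lemma IsQuadraticWith.mem_span_pair_of_commute_of_sq {m : A →ₗ[ℝ] A →ₗ[ℝ] A} {one : A}
    (hq : IsQuadraticWith m one) (hdiv : IsDivision m) {u v : A} {a b : ℝ}
    (hu : u ∉ Submodule.span ℝ {one}) (hu2 : m u u = a • one) (hv2 : m v v = b • one)
    (huv : m u v = m v u) : v ∈ Submodule.span ℝ {one, u} := by
  by_contra hv
  obtain ⟨c, d, hcd⟩ := hq.exists_sq_eq (u + v)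
  obtain ⟨c', d', hcd'⟩ := hq.exists_sq_eq (u - v)
  simp only [map_add, map_sub, LinearMap.add_apply, LinearMap.sub_apply, hu2, hv2, huv]
    at hcd hcd'
  have h1 : c - c' = 0 := by
    refine coeff_eq_zero_of_smul_mem
      (Submodule.mem_span_pair.2 ⟨2 * (a + b) - d - d', -(c + c'), ?_⟩) hv
    linear_combination (norm := module) hcd + hcd'
  have h2 : c + c' = 0 := by
    refine coeff_eq_zero_of_smul_mem
      (Submodule.mem_span_singleton.2 ⟨2 * (a + b) - d - d', ?_⟩) hu
    linear_combination (norm := module) hcd + hcd' + h1 • v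
  have hc : c = 0 := by linarith
  have hs : m u v = ((d - a - b) / 2) • one := by
    rw [huv]
    linear_combination (norm := module) (1 / 2 : ℝ) • hcd + (hc / 2) • (u + v)
  have hu0 : u ≠ 0 := fun h => hu (h ▸ Submodule.zero_mem _)
  have ha : a ≠ 0 := fun h => hu0 (hdiv.eq_zero_of_mul_eq_zero hu0 (by simp [hu2, h]))
  have hw : a • v - ((d - a - b) / 2) • u = 0 := by
    apply hdiv.eq_zero_of_mul_eq_zero hu0
    simp only [map_sub, map_smul, hs, hu2]
    module
  refine ha (coeff_eq_zero_of_smul_mem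
    (Submodule.mem_span_pair.2 ⟨0, (d - a - b) / 2, ?_⟩) hv)
  linear_combination (norm := module) -hw

lemma IsQuadraticWith.mem_span_pair_of_commute {m : A →ₗ[ℝ] A →ₗ[ℝ] A} {one : A}
    (hq : IsQuadraticWith m one) (hdiv : IsDivision m) {x y : A}
    (hx : x ∉ Submodule.span ℝ {one}) (hxy : m x y = m y x) :
    y ∈ Submodule.span ℝ {one, x} := by
  obtain ⟨a, b, hu⟩ := hq.exists_sub_sq_eq x
  obtain ⟨c, d, hv⟩ := hq.exists_sub_sq_eq y
  have hu1 : x - a • one ∉ Submodule.span ℝ {one} := by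
    rwa [Submodule.sub_mem_iff_left _ (Submodule.smul_mem _ _ (Submodule.mem_span_singleton_self _))]
  have huv : m (x - a • one) (y - c • one) = m (y - c • one) (x - a • one) := by
    simp only [map_sub, map_smul, LinearMap.sub_apply, LinearMap.smul_apply, (hq.1 _).1,
      (hq.1 _).2, hxy]
    module
  obtain ⟨p, q, h⟩ :=
    Submodule.mem_span_pair.1 (hq.mem_span_pair_of_commute_of_sq hdiv hu1 hu hv huv)
  refine Submodule.mem_span_pair.2 ⟨p - q * a + c, q, ?_⟩
  linear_combination (norm := module) h

lemma powerComm_isotope_smul_of_planar {m : A →ₗ[ℝ] A →ₗ[ℝ] A} {one : A}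
    (hq : IsQuadraticWith m one) {S : A →ₗ[ℝ] A} (hS : Planar m one S) (lam : ℝ) :
    PowerComm (isotope m (lam • S)) := by
  intro x a ha b hb
  have hinv : ∀ y ∈ Submodule.span ℝ {one, x}, (lam • S) y ∈ Submodule.span ℝ {one, x} :=
    fun y hy => Submodule.smul_mem _ _ (hS.2.2 _ (hq.isSubalg_span_pair x) y hy)
  have hle : genSubalg (isotope m (lam • S)) {x} ≤ Submodule.span ℝ {one, x} :=
    genSubalg_le
      (fun y hy z hz => hq.isSubalg_span_pair x _ (hinv y hy) _ (hinv z hz))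
      (Set.singleton_subset_iff.2 (Submodule.subset_span (by simp)))
  exact hq.mul_comm_of_mem_span_pair (hinv a (hle ha)) (hinv b (hle hb))

lemma PowerComm.map_sq_mem_span_pair {m : A →ₗ[ℝ] A →ₗ[ℝ] A} {one : A}
    (hq : IsQuadraticWith m one) (hdiv : IsDivision m) {T : A →ₗ[ℝ] A}
    (hT : Function.Surjective T) (h : PowerComm (isotope m T)) {y : A}
    (hy : y ∉ Submodule.span ℝ {one}) : T (m y y) ∈ Submodule.span ℝ {one, y} := by
  obtain ⟨x, rfl⟩ := hT y
  have hx : x ∈ genSubalg (isotope m T) {x} := subset_genSubalg _ _ rfl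
  exact hq.mem_span_pair_of_commute hdiv hy
    (h x x hx _ (isSubalg_genSubalg _ _ x hx x hx))

lemma PowerComm.map_one_mem_span_pair {m : A →ₗ[ℝ] A →ₗ[ℝ] A} {one : A}
    (hq : IsQuadraticWith m one) (hdiv : IsDivision m) {T : A →ₗ[ℝ] A}
    (hT : Function.Surjective T) (h : PowerComm (isotope m T)) {y : A}
    (hy : y ∉ Submodule.span ℝ {one}) : T one ∈ Submodule.span ℝ {one, y} := by
  obtain ⟨a, b, hab⟩ := hq.exists_sub_sq_eq y
  have hv : y - a • one ∉ Submodule.span ℝ {one} := by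
    rwa [Submodule.sub_mem_iff_left _ (Submodule.smul_mem _ _ (Submodule.mem_span_singleton_self _))]
  have hv0 : y - a • one ≠ 0 := fun h0 => hv (h0 ▸ Submodule.zero_mem _)
  have hb : b ≠ 0 := fun h0 => hv0 (hdiv.eq_zero_of_mul_eq_zero hv0 (by rw [hab, h0, zero_smul]))
  have hmem := h.map_sq_mem_span_pair hq hdiv hT hv
  rw [hab, map_smul, Submodule.smul_mem_iff _ hb] at hmem
  obtain ⟨p, q, hpq⟩ := Submodule.mem_span_pair.1 hmem
  refine Submodule.mem_span_pair.2 ⟨p - q * a, q, ?_⟩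
  linear_combination (norm := module) hpq

lemma PowerComm.map_one_mem_span_singleton [FiniteDimensional ℝ A]
    {m : A →ₗ[ℝ] A →ₗ[ℝ] A} {one : A}
    (hq : IsQuadraticWith m one) (hdiv : IsDivision m) (hdim : 2 < finrank ℝ A)
    {T : A →ₗ[ℝ] A} (hT : Function.Surjective T) (h : PowerComm (isotope m T)) :
    T one ∈ Submodule.span ℝ {one} := by
  obtain ⟨y, hy⟩ : ∃ y, y ∉ Submodule.span ℝ {one, T one} := by
    by_contra! hall
    have htop : Submodule.span ℝ {one, T one} = ⊤ := Submodule.eq_top_iff'.2 hall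
    classical
    have hle := finrank_span_finset_le_card (R := ℝ) ({one, T one} : Finset A)
    rw [Finset.coe_pair, Set.finrank, htop, finrank_top] at hle
    exact absurd (hle.trans Finset.card_le_two) (by omega)
  have hy1 : y ∉ Submodule.span ℝ {one} :=
    fun hmem => hy (Submodule.span_mono (by simp) hmem)
  obtain ⟨a, b, hab⟩ := Submodule.mem_span_pair.1 (h.map_one_mem_span_pair hq hdiv hT hy1)
  have hb : b = 0 := by
    refine coeff_eq_zero_of_smul_mem (Submodule.mem_span_pair.2 ⟨-a, 1, ?_⟩) hy
    linear_combination (norm := module) -hab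
  exact Submodule.mem_span_singleton.2 ⟨a, by simpa [hb] using hab⟩

lemma PowerComm.map_mem_span_pair {m : A →ₗ[ℝ] A →ₗ[ℝ] A} {one : A}
    (hq : IsQuadraticWith m one) (hdiv : IsDivision m) {T : A →ₗ[ℝ] A}
    (hT : Function.Surjective T) (h : PowerComm (isotope m T))
    (hone : T one ∈ Submodule.span ℝ {one}) (y : A) : T y ∈ Submodule.span ℝ {one, y} := by
  have hT1 : T one ∈ Submodule.span ℝ {one, y} := Submodule.span_mono (by simp) hone
  by_cases hy : y ∈ Submodule.span ℝ {one}
  · obtain ⟨c, rfl⟩ := Submodule.mem_span_singleton.1 hy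
    rw [map_smul]
    exact Submodule.smul_mem _ _ hT1
  have hy1 : y + one ∉ Submodule.span ℝ {one} := by
    rwa [Submodule.add_mem_iff_left _ (Submodule.mem_span_singleton_self _)]
  have h1 := h.map_sq_mem_span_pair hq hdiv hT hy
  have h2 : T (m (y + one) (y + one)) ∈ Submodule.span ℝ {one, y} := by
    obtain ⟨p, q, hpq⟩ := Submodule.mem_span_pair.1 (h.map_sq_mem_span_pair hq hdiv hT hy1)
    refine Submodule.mem_span_pair.2 ⟨p + q, q, ?_⟩
    linear_combination (norm := module) hpq
  rw [← Submodule.smul_mem_iff _ (two_ne_zero (α := ℝ))]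
  have h3 := Submodule.sub_mem _ (Submodule.sub_mem _ h2 h1) hT1
  convert h3 using 1
  simp only [map_add, LinearMap.add_apply, (hq.1 _).1, (hq.1 _).2]
  module

lemma PowerComm.exists_planar [FiniteDimensional ℝ A] {m : A →ₗ[ℝ] A →ₗ[ℝ] A} {one : A}
    (hq : IsQuadraticWith m one) (hdiv : IsDivision m) (hdim : 2 < finrank ℝ A)
    {T : A →ₗ[ℝ] A} (hT : Function.Bijective T) (h : PowerComm (isotope m T)) :
    ∃ (lam : ℝ) (S : A →ₗ[ℝ] A), lam ≠ 0 ∧ Planar m one S ∧ T = lam • S := by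
  have hone := h.map_one_mem_span_singleton hq hdiv hdim hT.2
  obtain ⟨lam, hlam⟩ := Submodule.mem_span_singleton.1 hone
  have : Nontrivial A := Module.nontrivial_of_finrank_pos (R := ℝ) (by omega)
  have hone0 : one ≠ 0 := by
    rintro rfl
    obtain ⟨x, hx⟩ := exists_ne (0 : A)
    exact hx (by simpa using (hq.1 x).1.symm)
  have hlam0 : lam ≠ 0 := by
    rintro rfl
    exact hone0 ((map_eq_zero_iff T hT.1).1 (by simpa using hlam.symm))
  refine ⟨lam, lam⁻¹ • T, hlam0, ⟨?_, ?_, ?_⟩, ?_⟩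
  · exact (MulAction.bijective₀ (inv_ne_zero hlam0)).comp hT
  · simp [← hlam, hlam0]
  · intro U hU x hx
    refine U.smul_mem _ ?_
    rcases eq_or_ne x 0 with rfl | hx0
    · simp
    · have hspan : Submodule.span ℝ {one, x} ≤ U :=
        Submodule.span_le.2
          (Set.pair_subset (hq.one_mem_of_isSubalg hdiv hU hx hx0) hx)
      exact hspan (h.map_mem_span_pair hq hdiv hT.2 hone x)
  · simp [smul_smul, hlam0]

/-- If squaring preserves every line of a plane, then some nonzero vector has square zero. -/
lemma exists_sq_eq_zero_of_sq_eq_smul {n : A →ₗ[ℝ] A →ₗ[ℝ] A} {U : Submodule ℝ A}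
    (hU : finrank ℝ U = 2) (h : ∀ u ∈ U, ∃ c : ℝ, n u u = c • u) :
    ∃ u : A, u ≠ 0 ∧ n u u = 0 := by
  by_contra! hn
  have : FiniteDimensional ℝ U := FiniteDimensional.of_finrank_pos (by omega)
  let β := Module.finBasisOfFinrankEq ℝ U hU
  have hli : ∀ s t : ℝ, s • (β 0 : A) + t • (β 1 : A) = 0 → s = 0 ∧ t = 0 := by
    have hβ : LinearIndependent ℝ ![β 0, β 1] := by
      convert β.linearIndependent using 1
      ext i
      fin_cases i <;> rfl
    intro s t hst
    exact LinearIndependent.pair_iff.1 hβ s t (Subtype.ext (by simpa using hst))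
  have hsq : ∀ s t : ℝ, ∃ c : ℝ, n (s • (β 0 : A) + t • (β 1 : A))
      (s • (β 0 : A) + t • (β 1 : A)) = c • (s • (β 0 : A) + t • (β 1 : A)) :=
    fun s t => h _ (U.add_mem (U.smul_mem _ (β 0).2) (U.smul_mem _ (β 1).2))
  obtain ⟨a, ha⟩ := h _ (β 0).2
  obtain ⟨b, hb⟩ := h _ (β 1).2
  have hu0 : (β 0 : A) ≠ 0 := fun h0 => by simpa using (hli 1 0 (by simp [h0])).1
  have hv0 : (β 1 : A) ≠ 0 := fun h0 => by simpa using (hli 0 1 (by simp [h0])).2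
  have ha0 : a ≠ 0 := by
    rintro rfl
    exact hn _ hu0 (by simp [ha])
  have hb0 : b ≠ 0 := by
    rintro rfl
    exact hn _ hv0 (by simp [hb])
  obtain ⟨c, hc⟩ := hsq b a
  obtain ⟨d, hd⟩ := hsq b (-a)
  have hd' := hd
  simp only [map_add, map_smul, LinearMap.add_apply, LinearMap.smul_apply, ha, hb] at hc hd
  obtain ⟨h1, h2⟩ := hli (2 * b ^ 2 * a - c * b - d * b) (2 * a ^ 2 * b - c * a + d * a) (by
    linear_combination (norm := module) hc + hd)
  have hd0 : d = 0 := by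
    have h3 : a * b * d = 0 := by linear_combination (b * h2 - a * h1) / 2
    simpa [ha0, hb0] using h3
  refine hn _ (fun h0 => hb0 (hli b (-a) h0).1) ?_
  rw [hd', hd0, zero_smul]

lemma Planar.omnipresent_isotope [Nontrivial A] {m : A →ₗ[ℝ] A →ₗ[ℝ] A} {one : A}
    (hq : IsQuadraticWith m one) (hdiv : IsDivision m) {T : A →ₗ[ℝ] A} (hT : Planar m one T) :
    Omnipresent (isotope m T) one := by
  refine ⟨?_, by simp [hT.2.1, (hq.1 one).1], fun U hU hU2 => ?_⟩
  · rintro rfl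
    obtain ⟨x, hx⟩ := exists_ne (0 : A)
    exact hx (by simpa using (hq.1 x).1.symm)
  by_contra hone
  obtain ⟨u, hu, hu2⟩ := exists_sq_eq_zero_of_sq_eq_smul (n := isotope m T) hU2 (by
    intro u hu
    have hTu := hT.2.2 _ (hq.isSubalg_span_pair u) u (Submodule.subset_span (by simp))
    obtain ⟨a, b, hab⟩ := Submodule.mem_span_pair.1 (hq.isSubalg_span_pair u _ hTu _ hTu)
    have ha : a = 0 := by
      refine coeff_eq_zero_of_smul_mem (U := U) ?_ hone
      rw [eq_sub_of_add_eq hab]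
      exact U.sub_mem (hU u hu u hu) (U.smul_mem b hu)
    exact ⟨b, by simp [← hab, ha]⟩)
  have hTu : T u ≠ 0 := fun h0 => hu ((map_eq_zero_iff T hT.1.1).1 h0)
  exact hTu (hdiv.eq_zero_of_mul_eq_zero hTu hu2)

end QuadraticAlgebra

/-- For a quadratic real division algebra `B` of dimension ≥ 4 and an
invertible linear map `T`, the isotope `B_T` is power-commutative iff `T = λ • S` for
some planar `S` and nonzero `λ`; moreover, if `T` is planar then `one` is an
omnipresent idempotent of `B_T`. -/
theorem stmt_12 {A : Type*} [AddCommGroup A] [Module ℝ A] [FiniteDimensional ℝ A]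
    (m : A →ₗ[ℝ] A →ₗ[ℝ] A) (hdiv : IsDivision m)
    (one : A) (hq : IsQuadraticWith m one)
    (hdim : 4 ≤ Module.finrank ℝ A)
    (T : A →ₗ[ℝ] A) (hbij : Function.Bijective T) :
    (PowerComm (isotope m T) ↔
      ∃ (lam : ℝ) (S : A →ₗ[ℝ] A), lam ≠ 0 ∧ Planar m one S ∧ T = lam • S) ∧
    (Planar m one T → Omnipresent (isotope m T) one) := by
  refine ⟨⟨fun h => h.exists_planar hq hdiv (by omega) hbij, ?_⟩, fun hT => ?_⟩
  · rintro ⟨lam, S, -, hS, rfl⟩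
    exact powerComm_isotope_smul_of_planar hq hS lam
  · have : Nontrivial A := Module.nontrivial_of_finrank_pos (R := ℝ) (by omega)
    exact hT.omnipresent_isotope hq hdiv
end

section
/- Let B be a quadratic real division algebra of dimension at least two and T : B → B a planar map, determined on Im B by the linear form σ : Im B → ℝ and the nonzero scalar λ (so T(v) = σ(v)·1 + λ·v for v ∈ Im B). Let S = sup{σ(x) : x ∈ B, x² = −1}. Then the isotope B_T has exactly one nonzero idempotent if and only if either λ > (S² + 1)/2, or S = 0 and λ = 1/2. -/
open Module

section Helpers

variable {A : Type*} [AddCommGroup A] [Module ℝ A] {m : A →ₗ[ℝ] A →ₗ[ℝ] A} {one : A}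

lemma IsDivision.eq_zero_or_eq_zero (hdiv : IsDivision m) {x y : A} (h : m x y = 0) :
    x = 0 ∨ y = 0 := by
  by_contra! hxy
  refine hxy.2 ((hdiv x hxy.1).1.1 ?_)
  simpa using h

lemma IsDivision.sq_ne_smul_one (hdiv : IsDivision m) (hone : ∀ x, m one x = x ∧ m x one = x)
    {y : A} {c : ℝ} (hc : 0 ≤ c) (hy : y ∉ Submodule.span ℝ {one}) : m y y ≠ c • one := by
  intro h
  have hmul : m (y - √c • one) (y + √c • one) = 0 := by
    simp only [map_sub, map_add, LinearMap.sub_apply, map_smul, LinearMap.smul_apply, h,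
      (hone _).1, (hone _).2]
    rw [smul_sub, smul_smul, Real.mul_self_sqrt hc]
    abel
  apply hy
  rw [Submodule.mem_span_singleton]
  rcases hdiv.eq_zero_or_eq_zero hmul with h | h
  · exact ⟨√c, (sub_eq_zero.mp h).symm⟩
  · exact ⟨-√c, by rw [neg_smul]; exact (eq_neg_of_add_eq_zero_left h).symm⟩

/-- An imaginary unit is not a multiple of the identity. -/
lemma notMem_span_of_sq_eq_neg_one (hone : ∀ x, m one x = x ∧ m x one = x) (h0 : one ≠ 0)
    {u : A} (hu : m u u = -one) : u ∉ Submodule.span ℝ {one} := by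
  rw [Submodule.mem_span_singleton]
  rintro ⟨c, rfl⟩
  have h : (c * c + 1) • one = 0 := by
    simp only [map_smul, LinearMap.smul_apply, (hone _).1, smul_smul] at hu
    rw [add_smul, hu, one_smul, neg_add_cancel]
  rcases smul_eq_zero.mp h with h | h
  · nlinarith [mul_self_nonneg c]
  · exact h0 h

/-- Coordinates with respect to `one` and an imaginary unit are unique. -/
lemma coords_unique {u : A} (h0 : one ≠ 0) (hu : u ∉ Submodule.span ℝ {one}) {a b a' b' : ℝ}
    (h : a • one + b • u = a' • one + b' • u) : a = a' ∧ b = b' := by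
  have h1 : (b - b') • u = (a' - a) • one := by
    rw [sub_smul, sub_smul, sub_eq_sub_iff_add_eq_add, add_comm, h]
  have hb : b = b' := by
    by_contra hb
    apply hu
    rw [Submodule.mem_span_singleton]
    refine ⟨(b - b')⁻¹ * (a' - a), ?_⟩
    rw [mul_smul, ← h1, inv_smul_smul₀ (sub_ne_zero.mpr hb)]
  refine ⟨?_, hb⟩
  subst hb
  simp only [sub_self, zero_smul] at h1
  rcases smul_eq_zero.mp h1.symm with h | h
  · linarith
  · exact absurd h h0

/-- Outside the line `ℝ one`, every element is `a • one + b • u` for an imaginary unit `u`. -/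
lemma exists_coords (hdiv : IsDivision m) (hq : IsQuadraticWith m one) (h0 : one ≠ 0)
    {x : A} (hx : x ∉ Submodule.span ℝ {one}) :
    ∃ (a b : ℝ) (u : A), m u u = -one ∧ x = a • one + b • u := by
  obtain ⟨hone, hdep⟩ := hq
  have hind : LinearIndependent ℝ ![one, x] := by
    rw [LinearIndependent.pair_iff]
    intro s t hst
    exact coords_unique h0 hx (a' := 0) (b' := 0) (by simpa using hst)
  have hmem : m x x ∈ Submodule.span ℝ {one, x} := by
    by_contra hmem
    have h := (linearIndependent_finSnoc (x := m x x)).mpr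
      ⟨hind, by simpa [Set.pair_comm] using hmem⟩
    apply hdep x
    have hsnoc : ![one, x, m x x] = Fin.snoc ![one, x] (m x x) := by
      ext i
      fin_cases i <;> rfl
    rwa [hsnoc]
  obtain ⟨β, α, hαβ⟩ := Submodule.mem_span_pair.mp hmem
  set y := x - (α / 2) • one with hy
  have hyspan : y ∉ Submodule.span ℝ {one} := by
    intro h
    apply hx
    have := Submodule.add_mem _ h
      (Submodule.smul_mem _ (α / 2) (Submodule.mem_span_singleton_self one))
    simpa [hy] using this
  have hyy : m y y = (β + α ^ 2 / 4) • one := by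
    simp only [hy, map_sub, LinearMap.sub_apply, map_smul, LinearMap.smul_apply,
      (hone _).1, (hone _).2, ← hαβ]
    module
  have hneg : β + α ^ 2 / 4 < 0 := by
    by_contra! hc
    exact hdiv.sq_ne_smul_one hone hc hyspan hyy
  set γ := -(β + α ^ 2 / 4) with hγ
  have hγpos : 0 < √γ := Real.sqrt_pos.mpr (by linarith)
  refine ⟨α / 2, √γ, (√γ)⁻¹ • y, ?_, ?_⟩
  · have hsq : √γ * √γ = γ := Real.mul_self_sqrt (by linarith)
    rw [map_smul, map_smul, LinearMap.smul_apply, hyy, smul_smul, smul_smul, ← mul_inv, hsq,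
      show β + α ^ 2 / 4 = -γ by linarith]
    have : γ⁻¹ * -γ = -1 := by
      have : γ ≠ 0 := by linarith
      field_simp
    rw [this, neg_one_smul]
  · rw [smul_inv_smul₀ hγpos.ne', hy]
    abel

lemma sq_coords (hone : ∀ x, m one x = x ∧ m x one = x) {u : A} (hu : m u u = -one) (p q : ℝ) :
    m (p • one + q • u) (p • one + q • u) = (p ^ 2 - q ^ 2) • one + (2 * p * q) • u := by
  simp only [map_add, LinearMap.add_apply, map_smul, LinearMap.smul_apply,
    (hone _).1, (hone _).2, hu]
  module

/-- The imaginary units of a finite-dimensional algebra without zero divisors form a compact set. -/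
lemma isCompact_imaginaryUnits {E : Type*} [NormedAddCommGroup E] [NormedSpace ℝ E]
    [FiniteDimensional ℝ E] (m : E →ₗ[ℝ] E →ₗ[ℝ] E) (hdiv : IsDivision m) (one : E) :
    IsCompact {x : E | m x x = -one} := by
  have : ProperSpace E := FiniteDimensional.proper ℝ E
  have hcont : Continuous fun x : E => m x x := by
    have h1 : Continuous fun x : E => (m x).toContinuousLinearMap :=
      (LinearMap.toContinuousLinearMap.toLinearMap ∘ₗ m).continuous_of_finiteDimensional
    exact h1.clm_apply continuous_id
  refine Metric.isCompact_of_isClosed_isBounded (isClosed_eq hcont continuous_const) ?_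
  rcases subsingleton_or_nontrivial E with hE | hE
  · exact (Set.toFinite _).isBounded
  obtain ⟨z, hz, hmin⟩ := (isCompact_sphere (0 : E) 1).exists_isMinOn
    (NormedSpace.sphere_nonempty.mpr zero_le_one) hcont.norm.continuousOn
  have hz0 : z ≠ 0 := by
    rintro rfl
    simp at hz
  have hc : 0 < ‖m z z‖ := norm_pos_iff.mpr fun h =>
    hz0 ((hdiv.eq_zero_or_eq_zero h).elim id id)
  refine isBounded_iff_forall_norm_le.mpr ⟨√(‖one‖ / ‖m z z‖), fun x hx => ?_⟩
  apply Real.le_sqrt_of_sq_le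
  rw [le_div_iff₀ hc]
  rcases eq_or_ne x 0 with rfl | hx0
  · simp
  have hn : ‖x‖ ≠ 0 := norm_ne_zero_iff.mpr hx0
  have hle := hmin (show ‖x‖⁻¹ • x ∈ Metric.sphere (0 : E) 1 by simp [norm_smul, hn])
  have hxx : m x x = -one := hx
  simp only [Set.mem_ofPred_eq, map_smul, LinearMap.smul_apply, norm_smul, norm_inv, norm_norm,
    hxx, norm_neg] at hle
  calc ‖x‖ ^ 2 * ‖m z z‖ ≤ ‖x‖ ^ 2 * (‖x‖⁻¹ * (‖x‖⁻¹ * ‖one‖)) := by gcongr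
    _ = ‖one‖ := by field_simp

/-- A linear form attains its supremum on the imaginary units. -/
lemma exists_isMaxOn_imaginaryUnits [FiniteDimensional ℝ A] (hdiv : IsDivision m)
    (σ : A →ₗ[ℝ] ℝ) (hne : {x : A | m x x = -one}.Nonempty) :
    ∃ u, m u u = -one ∧ ∀ v, m v v = -one → σ v ≤ σ u := by
  let φ := (finBasis ℝ A).equivFun
  let _ : NormedAddCommGroup A := NormedAddCommGroup.induced A _ φ φ.injective
  let _ : NormedSpace ℝ A := NormedSpace.induced ℝ A _ φ
  obtain ⟨u, hu, hmax⟩ := (isCompact_imaginaryUnits m hdiv one).exists_isMaxOn hne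
    σ.continuous_of_finiteDimensional.continuousOn
  exact ⟨u, hu, fun v hv => hmax hv⟩

end Helpers

/-- Let `B` be a quadratic real division algebra of dimension ≥ 2 and
`T` a planar map given on `Im B` by `T v = σ(v)·one + λ·v`, and let
`S = sup{σ(x) : x² = −1}`. Then the isotope `B_T` has exactly one nonzero idempotent
iff `λ > (S² + 1)/2`, or `S = 0` and `λ = 1/2`. -/
theorem stmt_15 {A : Type*} [AddCommGroup A] [Module ℝ A] [FiniteDimensional ℝ A]
    (m : A →ₗ[ℝ] A →ₗ[ℝ] A) (hdiv : IsDivision m)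
    (one : A) (hq : IsQuadraticWith m one)
    (hdim : 2 ≤ Module.finrank ℝ A)
    (T : A →ₗ[ℝ] A) (hT : Planar m one T)
    (σ : A →ₗ[ℝ] ℝ) (lam : ℝ) (hlam : lam ≠ 0)
    (hform : ∀ v ∈ ImSet m one, T v = σ v • one + lam • v)
    (S : ℝ) (hS : S = sSup (σ '' {x : A | m x x = -one})) :
    (∃! e : A, e ≠ 0 ∧ (isotope m T) e e = e) ↔
      (lam > (S ^ 2 + 1) / 2 ∨ (S = 0 ∧ lam = 1 / 2)) := by
  obtain ⟨hone, -⟩ := id hq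
  have h0 : one ≠ 0 := by
    rintro rfl
    have : Subsingleton A := ⟨fun x y => by rw [← (hone x).1, ← (hone y).1]; simp⟩
    have := finrank_zero_of_subsingleton (R := ℝ) (M := A)
    omega
  have hspan : ∀ u, m u u = -one → u ∉ Submodule.span ℝ {one} := fun u hu =>
    notMem_span_of_sq_eq_neg_one hone h0 hu
  have hne : {x : A | m x x = -one}.Nonempty := by
    obtain ⟨x, hx⟩ : ∃ x, x ∉ Submodule.span ℝ {one} := by
      by_contra! h
      have h1 := finrank_span_singleton (K := ℝ) h0
      rw [(Submodule.eq_top_iff').mpr h, finrank_top] at h1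
      omega
    obtain ⟨-, -, u, hu, -⟩ := exists_coords hdiv hq h0 hx
    exact ⟨u, hu⟩
  obtain ⟨u, hu, hmax⟩ := exists_isMaxOn_imaginaryUnits hdiv σ hne
  have hSu : S = σ u := by
    rw [hS]
    exact IsGreatest.csSup_eq ⟨⟨u, hu, rfl⟩, by rintro _ ⟨v, hv, rfl⟩; exact hmax v hv⟩
  have hsq_le : ∀ v, m v v = -one → σ v ^ 2 ≤ S ^ 2 := by
    intro v hv
    have h1 := hmax v hv
    have h2 := hmax (-v) (by simpa using hv)
    rw [map_neg] at h2
    rw [hSu]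
    exact sq_le_sq' (by linarith) h1
  have hIm : ∀ v, m v v = -one → v ∈ ImSet m one := fun v hv =>
    Or.inl ⟨hspan v hv, by
      rw [hv]; exact Submodule.neg_mem _ (Submodule.mem_span_singleton_self one)⟩
  have hiso : ∀ v, m v v = -one → ∀ a b : ℝ, isotope m T (a • one + b • v) (a • one + b • v) =
      ((a + b * σ v) ^ 2 - (b * lam) ^ 2) • one + (2 * (a + b * σ v) * (b * lam)) • v := by
    intro v hv a b
    have hTv : T (a • one + b • v) = (a + b * σ v) • one + (b * lam) • v := by
      rw [map_add, map_smul, map_smul, hT.2.1, hform v (hIm v hv)]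
      module
    rw [← sq_coords hone hv, ← hTv]
    rfl
  have hone_idem : one ≠ 0 ∧ isotope m T one one = one :=
    ⟨h0, by
      change m (T one) (T one) = one
      rw [hT.2.1, (hone one).1]⟩
  constructor
  · intro huniq
    by_contra! hcon
    obtain ⟨hle, hS0⟩ := hcon
    have hroot : ∀ b : ℝ, lam ^ 2 * b ^ 2 - S * b + (2 * lam - 1) / (4 * lam ^ 2) = 0 → b = 0 := by
      intro b hb
      have he : isotope m T ((1 / (2 * lam) - b * S) • one + b • u)
          ((1 / (2 * lam) - b * S) • one + b • u) = (1 / (2 * lam) - b * S) • one + b • u := by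
        rw [hiso u hu, ← hSu]
        congr 2
        · field_simp at hb ⊢
          linarith
        · field_simp
          ring
      by_contra hb0
      have hne0 : (1 / (2 * lam) - b * S) • one + b • u ≠ 0 := fun h =>
        hb0 (coords_unique h0 (hspan u hu) (a' := 0) (b' := 0) (by simpa using h)).2
      have heq := huniq.unique ⟨hne0, he⟩ hone_idem
      exact hb0 (coords_unique h0 (hspan u hu) (a' := 1) (b' := 0) (by simpa using heq)).2
    have hd : √(S ^ 2 + 1 - 2 * lam) ^ 2 = S ^ 2 + 1 - 2 * lam := Real.sq_sqrt (by linarith)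
    set d := √(S ^ 2 + 1 - 2 * lam)
    have h1 := hroot ((S + d) / (2 * lam ^ 2)) (by field_simp; linear_combination 4 * hd)
    have h2 := hroot ((S - d) / (2 * lam ^ 2)) (by field_simp; linear_combination 4 * hd)
    have hl2 : 2 * lam ^ 2 ≠ 0 := by positivity
    have h1' := (div_eq_zero_iff.mp h1).resolve_right hl2
    have h2' := (div_eq_zero_iff.mp h2).resolve_right hl2
    have hSz : S = 0 := by linarith
    have hdz : d = 0 := by linarith
    refine hS0 hSz ?_
    rw [hdz, hSz] at hd
    linarith
  · intro hcase
    refine ⟨one, hone_idem, ?_⟩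
    rintro e ⟨he0, he⟩
    by_cases hes : e ∈ Submodule.span ℝ {one}
    · obtain ⟨a, rfl⟩ := Submodule.mem_span_singleton.mp hes
      have ha0 : a ≠ 0 := by
        rintro rfl
        simp at he0
      have h := hiso u hu a 0
      rw [zero_smul, add_zero, he] at h
      have h' := (coords_unique h0 (hspan u hu) (a := a) (b := 0) (a' := a ^ 2) (b' := 0)
        (by simpa using h)).1
      have : a = 1 := mul_left_cancel₀ ha0 (by linarith)
      rw [this, one_smul]
    · obtain ⟨a, b, v, hv, rfl⟩ := exists_coords hdiv hq h0 hes
      have hb0 : b ≠ 0 := by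
        rintro rfl
        apply hes
        simpa using Submodule.smul_mem _ a (Submodule.mem_span_singleton_self one)
      rw [hiso v hv] at he
      obtain ⟨hre, him⟩ := coords_unique h0 (hspan v hv) he
      have hp : 2 * (a + b * σ v) * lam = 1 := mul_left_cancel₀ hb0 (by linarith)
      have hbpos : 0 < b ^ 2 := by positivity
      have hlpos : 0 < lam ^ 2 := by positivity
      have hdisc : (2 * lam ^ 2 * b - σ v) ^ 2 = σ v ^ 2 + 1 - 2 * lam := by
        linear_combination (-4 * lam ^ 2) * hre +
          (2 * (a + b * σ v) * lam + 1 - 2 * lam) * hp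
      have hle := hsq_le v hv
      exfalso
      rcases hcase with h | ⟨hSz, hl⟩
      · nlinarith [sq_nonneg (2 * lam ^ 2 * b - σ v)]
      · rw [hSz] at hle
        have hσ : σ v = 0 := by nlinarith
        rw [hσ, hl] at hdisc
        nlinarith
end
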